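/- arXiv:2312.07926 — 3 statements merged into one kernel-verified Lean document; each statement's English description precedes it below -/
import Mathlib

section
/- The function g(x) = 1/(2 cosh(πx/2)) is a probability density on ℝ, and ∫_ℝ e^{iθx} g(x) dx = 1/cosh θ for all real θ. -/
open MeasureTheory Real

/-- The Beta integral after the substitution `t = Real.sigmoid y`. -/
lemma betaIntegral_eq_integral_sigmoid (u v : ℂ) :
    Complex.betaIntegral u v =
      ∫ y : ℝ, (Real.sigmoid y : ℂ) ^ u * ((1 - Real.sigmoid y : ℝ) : ℂ) ^ v := by
  rw [Complex.betaIntegral, intervalIntegral.integral_of_le zero_le_one,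
    integral_Ioc_eq_integral_Ioo, ← Real.range_sigmoid, ← Set.image_univ,
    integral_image_eq_integral_abs_deriv_smul MeasurableSet.univ
      (fun x _ => (Real.hasDerivAt_sigmoid x).hasDerivWithinAt)
      Real.sigmoid_injective.injOn, setIntegral_univ]
  congr 1 with y
  have h₀ := Real.sigmoid_pos y
  have h₁ : 0 < 1 - Real.sigmoid y := sub_pos.2 (Real.sigmoid_lt_one y)
  have h₀' : (Real.sigmoid y : ℂ) ≠ 0 := by exact_mod_cast h₀.ne'
  have h₁' : (1 - (Real.sigmoid y : ℂ)) ≠ 0 := by exact_mod_cast h₁.ne'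
  rw [abs_of_pos (mul_pos h₀ h₁), Complex.real_smul]
  push_cast
  rw [Complex.cpow_sub _ _ h₀', Complex.cpow_sub _ _ h₁', Complex.cpow_one, Complex.cpow_one]
  field_simp

lemma sigmoid_cpow_mul_cpow (z : ℂ) (y : ℝ) :
    (Real.sigmoid y : ℂ) ^ (1 / 2 + z) * ((1 - Real.sigmoid y : ℝ) : ℂ) ^ (1 / 2 - z) =
      Complex.exp (z * y) * (1 / (2 * Real.cosh (y / 2)) : ℝ) := by
  have h₀ := Real.sigmoid_pos y
  have h₀' : (Real.sigmoid y : ℂ) ≠ 0 := by exact_mod_cast h₀.ne'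
  have hs : Real.sigmoid y * Real.exp (-y / 2) = 1 / (2 * Real.cosh (y / 2)) := by
    have h : Real.exp (-y) = Real.exp (-y / 2) * Real.exp (-y / 2) := by
      rw [← Real.exp_add]; ring_nf
    have h' : Real.exp (y / 2) = (Real.exp (-y / 2))⁻¹ := by rw [← Real.exp_neg]; ring_nf
    have hp := Real.exp_pos (-y / 2)
    rw [Real.sigmoid_def, Real.cosh_eq, h, h', ← neg_div]
    field_simp
  rw [← Real.sigmoid_neg, ← Real.sigmoid_mul_rexp_neg, Complex.ofReal_mul,
    Complex.mul_cpow_ofReal_nonneg h₀.le (Real.exp_pos _).le, ← mul_assoc,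
    ← Complex.cpow_add _ _ h₀', show (1 / 2 + z + (1 / 2 - z) : ℂ) = 1 by ring, Complex.cpow_one,
    Complex.cpow_def_of_ne_zero (by exact_mod_cast (Real.exp_pos (-y)).ne'),
    ← Complex.ofReal_log (Real.exp_pos _).le, Real.log_exp, ← hs,
    Complex.ofReal_mul, Complex.ofReal_exp, mul_left_comm, ← Complex.exp_add]
  push_cast
  ring_nf

lemma integral_exp_mul_sech (θ : ℝ) :
    ∫ x : ℝ, Complex.exp (θ * x * Complex.I) * (1 / (2 * Real.cosh (π * x / 2)) : ℝ)
      = 1 / (Real.cosh θ : ℂ) := by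
  have hπ : (π : ℂ) ≠ 0 := by exact_mod_cast pi_ne_zero
  set z : ℂ := θ / π * Complex.I with hz
  have hre : z.re = 0 := by rw [hz, ← Complex.ofReal_div, Complex.re_ofReal_mul]; simp
  have hbeta : ∫ y : ℝ, Complex.exp (z * y) * (1 / (2 * Real.cosh (y / 2)) : ℝ) =
      π / (Real.cosh θ : ℂ) := by
    simp_rw [← sigmoid_cpow_mul_cpow]
    rw [← betaIntegral_eq_integral_sigmoid,
      Complex.betaIntegral_eq_Gamma_mul_div _ _ (by simp [hre]) (by simp [hre]),
      show (1 / 2 + z + (1 / 2 - z) : ℂ) = 1 by ring, Complex.Gamma_one, div_one,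
      show (1 / 2 - z : ℂ) = 1 - (1 / 2 + z) by ring, Complex.Gamma_mul_Gamma_one_sub,
      show (π * (1 / 2 + z) : ℂ) = θ * Complex.I + π / 2 by rw [hz]; field_simp; ring,
      Complex.sin_add_pi_div_two, Complex.cos_mul_I, Complex.ofReal_cosh]
  have hscale := Measure.integral_comp_mul_left
    (fun y : ℝ => Complex.exp (z * y) * (1 / (2 * Real.cosh (y / 2)) : ℝ)) π
  rw [hbeta, abs_of_pos (inv_pos.2 pi_pos), Complex.real_smul] at hscale
  convert hscale using 1
  · congr 1 with x
    congr 2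
    rw [hz]
    push_cast
    field_simp
  · push_cast
    field_simp

/-- g(x) = 1/(2 cosh(πx/2)) is a probability density on ℝ with characteristic
function 1/cosh θ. -/
theorem cosh_density_char :
    (∀ x : ℝ, 0 ≤ 1 / (2 * Real.cosh (π * x / 2))) ∧
    (∫ x : ℝ, 1 / (2 * Real.cosh (π * x / 2)) = 1) ∧
    (∀ θ : ℝ,
      ∫ x : ℝ, Complex.exp (θ * x * Complex.I) * (1 / (2 * Real.cosh (π * x / 2)) : ℝ)
        = 1 / (Real.cosh θ : ℂ)) := by
  refine ⟨fun x => by have := Real.cosh_pos (π * x / 2); positivity, ?_, integral_exp_mul_sech⟩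
  have h := integral_exp_mul_sech 0
  simp only [Complex.ofReal_zero, zero_mul, Complex.exp_zero, one_mul, Real.cosh_zero,
    Complex.ofReal_one, div_one] at h
  rw [integral_complex_ofReal] at h
  exact_mod_cast h
end

section
/- The function g₂(x) = x/(2 sinh(πx/2)) (extended continuously at 0 by the value 1/π) is a probability density on ℝ with characteristic function 1/cosh²(θ). -/
open MeasureTheory Real

open scoped FourierTransform

/-- The density `x / (2 sinh (π x / 2))`, extended by its limit `1 / π` at `0`. -/
noncomputable def sinhDensity (x : ℝ) : ℝ :=
  if x = 0 then 1 / π else x / (2 * Real.sinh (π * x / 2))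

lemma add_cube_div_six_le_sinh {x : ℝ} (hx : 0 ≤ x) : x + x ^ 3 / 6 ≤ Real.sinh x := by
  have h := sum_le_hasSum (Finset.range 2) (fun n _ => by positivity) (Real.hasSum_sinh x)
  norm_num [Finset.sum_range_succ, Nat.factorial] at h
  exact h

lemma sinhDensity_neg (x : ℝ) : sinhDensity (-x) = sinhDensity x := by
  simp only [sinhDensity, neg_eq_zero, mul_neg, neg_div, div_neg, Real.sinh_neg, neg_neg]

lemma sinhDensity_abs (x : ℝ) : sinhDensity |x| = sinhDensity x := by
  rcases abs_choice x with h | h <;> rw [h]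
  exact sinhDensity_neg x

lemma sinhDensity_nonneg (x : ℝ) : 0 ≤ sinhDensity x := by
  rw [← sinhDensity_abs, sinhDensity]
  split_ifs
  · positivity
  · have : 0 ≤ Real.sinh (π * |x| / 2) := Real.sinh_nonneg_iff.2 (by positivity)
    positivity

lemma sinhDensity_le (x : ℝ) : sinhDensity x ≤ (1 + x ^ 2)⁻¹ := by
  rw [← sinhDensity_abs, ← sq_abs x]
  generalize hy : |x| = y
  have hy0 : 0 ≤ y := hy ▸ abs_nonneg x
  have hpi := Real.pi_gt_three
  rw [sinhDensity]
  split_ifs with h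
  · rw [h, div_le_iff₀ Real.pi_pos]
    norm_num
    linarith
  · have hy1 : 0 < y := lt_of_le_of_ne hy0 (Ne.symm h)
    have hs := add_cube_div_six_le_sinh (x := π * y / 2) (by positivity)
    have hs0 : 0 < Real.sinh (π * y / 2) := Real.sinh_pos_iff.2 (by positivity)
    rw [← one_div, div_le_div_iff₀ (by positivity) (by positivity)]
    have h1 : 3 * y ≤ π * y := by gcongr
    have h3 : (3 * y) ^ 3 ≤ (π * y) ^ 3 := by gcongr
    have h4 : 0 ≤ y ^ 3 := by positivity
    nlinarith

lemma measurable_sinhDensity : Measurable sinhDensity := by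
  unfold sinhDensity
  refine Measurable.ite (measurableSet_singleton 0) measurable_const ?_
  fun_prop

lemma integrable_sinhDensity : Integrable sinhDensity :=
  integrable_inv_one_add_sq.mono' measurable_sinhDensity.aestronglyMeasurable <|
    .of_forall fun x => by
      rw [Real.norm_of_nonneg (sinhDensity_nonneg x)]
      exact sinhDensity_le x

lemma Gamma_mul_Gamma_eq_sinhDensity (w : ℝ) :
    Complex.Gamma (1 - 2 * π * w * Complex.I) * Complex.Gamma (1 + 2 * π * w * Complex.I) =
      (π * sinhDensity (4 * π * w) : ℝ) := by
  by_cases hw : w = 0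
  · simp [hw, sinhDensity]
  have hz : 2 * π * w * Complex.I ≠ 0 := by
    simp [hw, Real.pi_ne_zero]
  have hx : 4 * π * w ≠ 0 := by simp [hw, Real.pi_ne_zero]
  rw [add_comm, Complex.Gamma_add_one _ hz, mul_left_comm, mul_comm (Complex.Gamma (1 - _)),
    Complex.Gamma_mul_Gamma_one_sub, ← mul_assoc, Complex.sin_mul_I, sinhDensity, if_neg hx]
  have harg : π * (4 * π * w) / 2 = π * (2 * π * w) := by ring
  have hs : Complex.sinh (π * (2 * π * w)) ≠ 0 := by
    have : Real.sinh (π * (2 * π * w)) ≠ 0 := by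
      simp [hw, Real.pi_ne_zero]
    exact_mod_cast this
  rw [harg]
  push_cast
  field_simp [Complex.I_ne_zero]
  ring

lemma integral_sigmoid_eq_betaIntegral (z : ℂ) :
    ∫ y : ℝ, Complex.exp (-(y * z)) * (sigmoid y * (1 - sigmoid y) : ℝ) =
      Complex.betaIntegral (1 - z) (1 + z) := by
  rw [Complex.betaIntegral, intervalIntegral.integral_of_le zero_le_one,
    integral_Ioc_eq_integral_Ioo, ← Real.range_sigmoid, ← Set.image_univ,
    integral_image_eq_integral_abs_deriv_smul MeasurableSet.univ
      (fun x _ => (hasDerivAt_sigmoid x).hasDerivWithinAt) Real.sigmoid_injective.injOn,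
    setIntegral_univ]
  refine integral_congr_ae (.of_forall fun y => ?_)
  have h0 := Real.sigmoid_pos y
  have h1 : 0 < 1 - sigmoid y := sub_pos.2 (Real.sigmoid_lt_one y)
  have hlog : Real.log (1 - sigmoid y) = Real.log (sigmoid y) - y := by
    rw [← Real.sigmoid_neg, ← Real.sigmoid_mul_rexp_neg, Real.log_mul h0.ne' (exp_pos _).ne',
      Real.log_exp, sub_eq_add_neg]
  have hc : (1 : ℂ) - (sigmoid y : ℂ) = ((1 - sigmoid y : ℝ) : ℂ) := by push_cast; rfl
  simp only
  rw [abs_of_pos (mul_pos h0 h1), Complex.real_smul, mul_comm, hc,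
    Complex.cpow_def_of_ne_zero (by exact_mod_cast h0.ne'),
    Complex.cpow_def_of_ne_zero (by exact_mod_cast h1.ne'), ← Complex.ofReal_log h0.le,
    ← Complex.ofReal_log h1.le, hlog, ← Complex.exp_add]
  congr 2
  push_cast
  ring

lemma integrable_sigmoid_mul_one_sub :
    Integrable fun y : ℝ => sigmoid y * (1 - sigmoid y) := by
  have h : IntegrableOn (fun _ : ℝ => (1 : ℝ)) (sigmoid '' Set.univ) := by
    rw [Set.image_univ, Real.range_sigmoid]
    exact integrableOn_const (by simp)
  rw [integrableOn_image_iff_integrableOn_abs_deriv_smul MeasurableSet.univ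
      (fun x _ => (hasDerivAt_sigmoid x).hasDerivWithinAt) Real.sigmoid_injective.injOn,
    integrableOn_univ] at h
  refine h.congr (.of_forall fun y => ?_)
  have h0 := Real.sigmoid_pos y
  have h1 : 0 < 1 - sigmoid y := sub_pos.2 (Real.sigmoid_lt_one y)
  simp [abs_of_pos h0, abs_of_pos h1]

lemma fourier_sigmoid_mul_one_sub :
    𝓕 (fun y : ℝ => ((sigmoid y * (1 - sigmoid y) : ℝ) : ℂ)) =
      fun w : ℝ => ((π * sinhDensity (4 * π * w) : ℝ) : ℂ) := by
  ext w
  have hbeta := Complex.Gamma_mul_Gamma_eq_betaIntegral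
    (s := 1 - 2 * π * w * Complex.I) (t := 1 + 2 * π * w * Complex.I) (by simp) (by simp)
  rw [Gamma_mul_Gamma_eq_sinhDensity, show (1 - 2 * π * w * Complex.I) +
    (1 + 2 * π * w * Complex.I) = 1 + 1 by ring, Complex.Gamma_add_one _ one_ne_zero,
    Complex.Gamma_one, one_mul, one_mul, ← integral_sigmoid_eq_betaIntegral] at hbeta
  rw [hbeta, Real.fourier_real_eq_integral_exp_smul]
  congr! 4 with y
  push_cast
  ring

lemma sigmoid_mul_one_sub_two_mul (θ : ℝ) :
    sigmoid (2 * θ) * (1 - sigmoid (2 * θ)) = 1 / (4 * Real.cosh θ ^ 2) := by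
  rw [← Real.sigmoid_neg, Real.sigmoid_def, Real.sigmoid_def, Real.cosh_eq, neg_neg,
    show -(2 * θ) = -θ + -θ by ring, show 2 * θ = θ + θ by ring, Real.exp_add, Real.exp_add,
    Real.exp_neg]
  have := Real.exp_pos θ
  field_simp
  ring

lemma integral_exp_mul_sinhDensity (θ : ℝ) :
    ∫ x : ℝ, Complex.exp (θ * x * Complex.I) * (sinhDensity x : ℝ) =
      1 / (Real.cosh θ : ℂ) ^ 2 := by
  have hpi : 4 * π ≠ 0 := by positivity
  have hF : Integrable (𝓕 (fun y : ℝ => ((sigmoid y * (1 - sigmoid y) : ℝ) : ℂ))) := by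
    rw [fourier_sigmoid_mul_one_sub]
    exact ((integrable_sinhDensity.comp_mul_left' hpi).const_mul π).ofReal
  have hcont : Continuous fun y : ℝ => ((sigmoid y * (1 - sigmoid y) : ℝ) : ℂ) := by
    have := continuous_sigmoid
    fun_prop
  have hinv := congrFun
    (hcont.fourierInv_fourier_eq integrable_sigmoid_mul_one_sub.ofReal hF) (2 * θ)
  rw [fourier_sigmoid_mul_one_sub, Real.fourierInv_eq', sigmoid_mul_one_sub_two_mul] at hinv
  have hscale := Measure.integral_comp_mul_left
    (fun x : ℝ => Complex.exp (θ * x * Complex.I) * (sinhDensity x : ℝ)) (4 * π)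
  have hcongr : ∫ w : ℝ, Complex.exp (↑(2 * π * inner ℝ w (2 * θ)) * Complex.I) •
      ((π * sinhDensity (4 * π * w) : ℝ) : ℂ) = π * ∫ w : ℝ,
      Complex.exp (θ * (4 * π * w : ℝ) * Complex.I) * (sinhDensity (4 * π * w) : ℝ) := by
    rw [← integral_const_mul]
    refine integral_congr_ae (.of_forall fun w => ?_)
    have harg : ((2 * π * inner ℝ w (2 * θ) : ℝ) : ℂ) = θ * (4 * π * w : ℝ) := by
      simp only [RCLike.inner_apply, conj_trivial]
      push_cast
      ring
    simp only [harg, smul_eq_mul]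
    push_cast
    ring
  rw [hcongr, hscale, abs_of_pos (by positivity), Complex.real_smul] at hinv
  have hpi' : (π : ℂ) ≠ 0 := by exact_mod_cast Real.pi_ne_zero
  have hcosh : Complex.cosh θ ≠ 0 := by exact_mod_cast (Real.cosh_pos θ).ne'
  push_cast at hinv ⊢
  field_simp at hinv
  rw [eq_div_iff (pow_ne_zero 2 hcosh)]
  exact hinv

/-- g₂(x) = x/(2 sinh(πx/2)) (value 1/π at x = 0) is a probability density on ℝ
with characteristic function 1/cosh²θ. -/
theorem cosh2_density_char
    (g₂ : ℝ → ℝ) (hg₂ : ∀ x, g₂ x = if x = 0 then 1 / π else x / (2 * Real.sinh (π * x / 2))) :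
    (∀ x : ℝ, 0 ≤ g₂ x) ∧
    (∫ x : ℝ, g₂ x = 1) ∧
    (∀ θ : ℝ,
      ∫ x : ℝ, Complex.exp (θ * x * Complex.I) * (g₂ x : ℝ)
        = 1 / (Real.cosh θ : ℂ) ^ 2) := by
  obtain rfl : g₂ = sinhDensity := funext hg₂
  refine ⟨sinhDensity_nonneg, ?_, integral_exp_mul_sinhDensity⟩
  have h := integral_exp_mul_sinhDensity 0
  simp only [Complex.ofReal_zero, zero_mul, Complex.exp_zero, one_mul, Real.cosh_zero,
    Complex.ofReal_one, one_pow, div_one, integral_complex_ofReal] at h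
  exact_mod_cast h
end

section
/- The function h(x) = (1/π) log coth(π|x|/4) is a probability density on ℝ, and ∫_ℝ e^{iθx} h(x) dx = tanh(θ)/θ for all real θ ≠ 0. -/
open MeasureTheory Real

theorem HasSum.odd_of_even {f : ℕ → ℝ} {a b : ℝ} (hf : HasSum f a)
    (he : HasSum (fun k => f (2 * k)) b) : HasSum (fun k => f (2 * k + 1)) (a - b) := by
  have hinj : Function.Injective fun k : ℕ => 2 * k + 1 := fun m n hmn => by
    simpa using hmn
  have ho : Summable fun k => f (2 * k + 1) := hf.summable.comp_injective hinj
  have h := (HasSum.even_add_odd he ho.hasSum).unique hf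
  rw [← h, add_sub_cancel_left]
  exact ho.hasSum

theorem hasSum_inv_odd_sq :
    HasSum (fun k : ℕ => 1 / (2 * (k : ℝ) + 1) ^ 2) (π ^ 2 / 8) := by
  have he : HasSum (fun k : ℕ => 1 / ((2 * k : ℕ) : ℝ) ^ 2) (1 / 4 * (π ^ 2 / 6)) := by
    refine (hasSum_zeta_two.mul_left (1 / 4)).congr_fun fun k => ?_
    push_cast
    rw [mul_pow, one_div_mul_one_div]
    norm_num
  convert! hasSum_zeta_two.odd_of_even he using 1
  · push_cast
    rfl
  · ring

/-- The partial fraction expansion of the hyperbolic cotangent. -/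
theorem hasSum_coth {t : ℝ} (ht : t ≠ 0) :
    HasSum (fun n : ℕ => 2 * t / (t ^ 2 + (n : ℝ) ^ 2))
      (π * (Real.cosh (π * t) / Real.sinh (π * t)) + 1 / t) := by
  have hz : (t * Complex.I : ℂ) ∈ Complex.integerComplement := by
    rintro ⟨n, hn⟩
    have := congrArg Complex.im hn
    simp at this
    exact ht this.symm
  have hs := ((summable_cotTerm hz).hasSum_iff_tendsto_nat.mpr
    (tendsto_logDeriv_euler_cot_sub hz)).mul_left Complex.I
  rw [← hasSum_nat_add_iff' 1, ← Complex.hasSum_ofReal]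
  have htc : (t : ℂ) ≠ 0 := by exact_mod_cast ht
  convert! hs using 1
  · ext n
    rw [cotTerm_identity hz]
    have h1 : (t : ℂ) ^ 2 + (n + 1) ^ 2 ≠ 0 := by
      norm_cast
      positivity
    have h2 : (t * Complex.I + (n + 1)) * (t * Complex.I - (n + 1))
        = -((t : ℂ) ^ 2 + (n + 1) ^ 2) := by
      linear_combination (t : ℂ) ^ 2 * Complex.I_sq
    rw [h2]
    push_cast
    field_simp
    linear_combination Complex.I_sq
  · have hsinh : Complex.sinh (π * t) ≠ 0 := by
      rw [← Complex.ofReal_mul, ← Complex.ofReal_sinh]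
      exact_mod_cast Real.sinh_ne_zero.mpr (mul_ne_zero pi_ne_zero ht)
    rw [Complex.cot, ← mul_assoc (π : ℂ), Complex.cos_mul_I, Complex.sin_mul_I]
    push_cast
    simp only [Finset.range_one, Finset.sum_singleton, CharP.cast_eq_zero]
    field_simp
    ring

/-- The partial fraction expansion of the hyperbolic tangent. -/
theorem hasSum_tanh {θ : ℝ} (hθ : θ ≠ 0) :
    HasSum (fun k : ℕ => 2 / (((2 * k + 1) * (π / 2)) ^ 2 + θ ^ 2)) (Real.tanh θ / θ) := by
  have ht : θ / π ≠ 0 := div_ne_zero hθ pi_ne_zero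
  have hf := hasSum_coth (mul_ne_zero two_ne_zero ht)
  have he : HasSum (fun k : ℕ => 2 * (2 * (θ / π)) / ((2 * (θ / π)) ^ 2 + ((2 * k : ℕ) : ℝ) ^ 2))
      (1 / 2 * (π * (Real.cosh (π * (θ / π)) / Real.sinh (π * (θ / π))) + 1 / (θ / π))) := by
    refine ((hasSum_coth ht).mul_left (1 / 2)).congr_fun fun k => ?_
    have : (θ / π) ^ 2 + (k : ℝ) ^ 2 ≠ 0 := by positivity
    have h2 : (2 * (θ / π)) ^ 2 + ((2 * k : ℕ) : ℝ) ^ 2 = 4 * ((θ / π) ^ 2 + (k : ℝ) ^ 2) := by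
      push_cast
      ring
    rw [h2]
    field_simp
    norm_num
  convert! (hf.odd_of_even he).mul_left (2 / (π * θ)) using 1
  · ext k
    have h1 : ((2 * k + 1) * (π / 2)) ^ 2 + θ ^ 2 ≠ 0 := by positivity
    have h2 : (2 * (θ / π)) ^ 2 + ((2 * k + 1 : ℕ) : ℝ) ^ 2
        = 4 / π ^ 2 * (((2 * k + 1) * (π / 2)) ^ 2 + θ ^ 2) := by
      push_cast
      field_simp
      ring
    rw [h2]
    field_simp
    norm_num
  · rw [show π * (2 * (θ / π)) = 2 * θ by field_simp, mul_div_cancel₀ _ pi_ne_zero,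
      Real.sinh_two_mul, Real.cosh_two_mul, Real.tanh_eq_sinh_div_cosh]
    have h1 := Real.sinh_ne_zero.mpr hθ
    have h2 := (Real.cosh_pos θ).ne'
    field_simp
    ring

theorem integrable_exp_mul_I_mul_exp_neg_mul_abs {a : ℝ} (ha : 0 < a) (θ : ℝ) :
    Integrable fun x : ℝ => Complex.exp (θ * x * Complex.I) * (Real.exp (-(a * |x|)) : ℂ) := by
  have hI : IntegrableOn (fun x : ℝ => Real.exp (-(a * x))) (Set.Ioi 0) := by
    simpa using integrableOn_exp_mul_Ioi (neg_lt_zero.mpr ha) 0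
  have hr : Integrable fun x : ℝ => Real.exp (-(a * |x|)) := by
    rw [← integrableOn_univ, ← Set.Iic_union_Ioi (a := (0 : ℝ))]
    refine .union ?_ (hI.congr_fun (fun x hx => ?_) measurableSet_Ioi)
    · refine (integrableOn_exp_mul_Iic ha 0).congr_fun (fun x hx => ?_) measurableSet_Iic
      simp [abs_of_nonpos (Set.mem_Iic.mp hx)]
    · simp [abs_of_pos (Set.mem_Ioi.mp hx)]
  refine hr.mono' (by fun_prop) (.of_forall fun x => ?_)
  rw [norm_mul, Complex.norm_real, ← Complex.ofReal_mul, Complex.norm_exp_ofReal_mul_I, one_mul,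
    Real.norm_of_nonneg (Real.exp_pos _).le]

theorem integral_exp_mul_I_mul_exp_neg_mul_abs {a : ℝ} (ha : 0 < a) (θ : ℝ) :
    ∫ x : ℝ, Complex.exp (θ * x * Complex.I) * (Real.exp (-(a * |x|)) : ℂ)
      = (2 * a / (a ^ 2 + θ ^ 2) : ℝ) := by
  have hint := integrable_exp_mul_I_mul_exp_neg_mul_abs ha θ
  rw [← intervalIntegral.integral_Iic_add_Ioi (b := 0) hint.integrableOn hint.integrableOn]
  have h1 : ∫ x in Set.Iic (0 : ℝ), Complex.exp (θ * x * Complex.I) * (Real.exp (-(a * |x|)) : ℂ)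
      = ∫ x in Set.Iic (0 : ℝ), Complex.exp ((a + θ * Complex.I) * x) := by
    refine setIntegral_congr_fun measurableSet_Iic fun x hx => ?_
    simp only [abs_of_nonpos (Set.mem_Iic.mp hx), Complex.ofReal_exp, ← Complex.exp_add]
    congr 1
    push_cast
    ring
  have h2 : ∫ x in Set.Ioi (0 : ℝ), Complex.exp (θ * x * Complex.I) * (Real.exp (-(a * |x|)) : ℂ)
      = ∫ x in Set.Ioi (0 : ℝ), Complex.exp ((-a + θ * Complex.I) * x) := by
    refine setIntegral_congr_fun measurableSet_Ioi fun x hx => ?_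
    simp only [abs_of_pos (Set.mem_Ioi.mp hx), Complex.ofReal_exp, ← Complex.exp_add]
    congr 1
    push_cast
    ring
  rw [h1, h2, integral_exp_mul_complex_Iic (by simpa using ha),
    integral_exp_mul_complex_Ioi (by simpa using ha)]
  have h3 : (a + θ * Complex.I : ℂ) ≠ 0 := fun h => ha.ne' (by simpa using congrArg Complex.re h)
  have h4 : (-a + θ * Complex.I : ℂ) ≠ 0 := fun h => ha.ne' (by simpa using congrArg Complex.re h)
  have h5 : (a ^ 2 + θ ^ 2 : ℂ) ≠ 0 := by
    norm_cast
    positivity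
  simp only [Complex.ofReal_zero, mul_zero, Complex.exp_zero]
  push_cast
  field_simp
  linear_combination (-2 * a * θ ^ 2 : ℂ) * Complex.I_sq

theorem one_lt_cosh_div_sinh {y : ℝ} (hy : 0 < y) : 1 < Real.cosh y / Real.sinh y := by
  rw [one_lt_div (Real.sinh_pos_iff.mpr hy)]
  exact Real.sinh_lt_cosh y

/-- The expansion of `log coth` in powers of `exp (-2y)`. -/
theorem hasSum_log_coth {y : ℝ} (hy : 0 < y) :
    HasSum (fun k : ℕ => 2 / (2 * k + 1) * Real.exp (-((2 * k + 1) * (2 * y))))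
      (Real.log (Real.cosh y / Real.sinh y)) := by
  have hq : Real.exp (-(2 * y)) < 1 := Real.exp_lt_one_iff.mpr (by linarith)
  have hq0 := Real.exp_pos (-(2 * y))
  convert! hasSum_log_sub_log_of_abs_lt_one (abs_lt.mpr ⟨by linarith, hq⟩) using 1
  · ext k
    rw [← Real.exp_nat_mul]
    push_cast
    rw [mul_one_div]
    congr 2
    ring
  · rw [← Real.log_div (by linarith) (by linarith), Real.cosh_eq, Real.sinh_eq]
    have h1 : Real.exp (-(2 * y)) = Real.exp (-y) * Real.exp (-y) := by
      rw [← Real.exp_add]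
      ring_nf
    have h2 : Real.exp y * Real.exp (-y) = 1 := by
      rw [← Real.exp_add]
      simp
    have h3 : 0 < Real.exp y - Real.exp (-y) := sub_pos.mpr (Real.exp_lt_exp.mpr (by linarith))
    congr 1
    rw [div_div_div_cancel_right₀ two_ne_zero, div_eq_div_iff h3.ne' (by linarith), h1]
    linear_combination -2 * Real.exp (-y) * h2

theorem hasSum_integral_exp_mul_I_mul_log_coth (θ : ℝ) :
    HasSum (fun k : ℕ => ((2 / (((2 * k + 1) * (π / 2)) ^ 2 + θ ^ 2) : ℝ) : ℂ))
      (∫ x : ℝ, Complex.exp (θ * x * Complex.I) *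
        (((1 / π) * Real.log (Real.cosh (π * |x| / 4) / Real.sinh (π * |x| / 4)) : ℝ) : ℂ)) := by
  have hpos (k : ℕ) : 0 < (2 * k + 1) * (π / 2) := by positivity
  let F (k : ℕ) (x : ℝ) : ℂ := (2 / (π * (2 * k + 1)) : ℝ) *
    (Complex.exp (θ * x * Complex.I) * (Real.exp (-((2 * k + 1) * (π / 2) * |x|)) : ℂ))
  have hF (k : ℕ) : Integrable (F k) :=
    (integrable_exp_mul_I_mul_exp_neg_mul_abs (hpos k) θ).const_mul _
  have hnorm (k : ℕ) : ∫ x, ‖F k x‖ = 8 / π ^ 2 * (1 / (2 * (k : ℝ) + 1) ^ 2) := by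
    have h1 (x : ℝ) : ‖F k x‖
        = 2 / (π * (2 * k + 1)) * Real.exp (-((2 * k + 1) * (π / 2) * |x|)) := by
      rw [norm_mul, norm_mul, Complex.norm_real, Complex.norm_real, ← Complex.ofReal_mul,
        Complex.norm_exp_ofReal_mul_I, one_mul, Real.norm_of_nonneg (Real.exp_pos _).le,
        Real.norm_of_nonneg (by positivity)]
    have h2 := integral_exp_mul_I_mul_exp_neg_mul_abs (hpos k) 0
    simp only [Complex.ofReal_zero, zero_mul, Complex.exp_zero, one_mul] at h2
    rw [integral_complex_ofReal, Complex.ofReal_inj] at h2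
    simp_rw [h1]
    rw [integral_const_mul, h2]
    field_simp
    ring
  have hsum : Summable fun k => ∫ x, ‖F k x‖ := by
    simp_rw [hnorm]
    exact hasSum_inv_odd_sq.summable.mul_left _
  convert! hasSum_integral_of_summable_integral_norm hF hsum using 1
  · ext k
    rw [integral_const_mul, integral_exp_mul_I_mul_exp_neg_mul_abs (hpos k), ← Complex.ofReal_mul]
    congr 1
    have : ((2 * k + 1) * (π / 2)) ^ 2 + θ ^ 2 ≠ 0 := by have := hpos k; positivity
    field_simp
  · refine integral_congr_ae ?_
    filter_upwards [Measure.ae_ne volume 0] with x hx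
    have hy : 0 < π * |x| / 4 := by positivity
    have hs := (Complex.hasSum_ofReal.mpr ((hasSum_log_coth hy).mul_left (1 / π))).mul_left
      (Complex.exp (θ * x * Complex.I))
    rw [← hs.tsum_eq]
    refine tsum_congr fun k => ?_
    have h1 : (2 * k + 1) * (2 * (π * |x| / 4)) = (2 * k + 1) * (π / 2) * |x| := by ring
    simp only [F, h1]
    push_cast
    field_simp

/-- h(x) = (1/π) log coth(π|x|/4) is a probability density on ℝ with characteristic
function tanh(θ)/θ for θ ≠ 0. -/
theorem tanh_density_char
    (h : ℝ → ℝ)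
    (hh : ∀ x, h x = (1 / π) * Real.log (Real.cosh (π * |x| / 4) / Real.sinh (π * |x| / 4))) :
    (∀ x : ℝ, x ≠ 0 → 0 ≤ h x) ∧
    (∫ x : ℝ, h x = 1) ∧
    (∀ θ : ℝ, θ ≠ 0 →
      ∫ x : ℝ, Complex.exp (θ * x * Complex.I) * (h x : ℝ)
        = (Real.tanh θ : ℂ) / θ) := by
  obtain rfl : h = _ := funext hh
  refine ⟨fun x hx => ?_, ?_, fun θ hθ => ?_⟩
  · have hy : 0 < π * |x| / 4 := by positivity
    exact mul_nonneg (by positivity) (Real.log_nonneg (one_lt_cosh_div_sinh hy).le)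
  · have hs := hasSum_integral_exp_mul_I_mul_log_coth 0
    simp only [Complex.ofReal_zero, zero_mul, Complex.exp_zero, one_mul] at hs
    rw [integral_complex_ofReal, Complex.hasSum_ofReal] at hs
    refine hs.unique ?_
    convert! hasSum_inv_odd_sq.mul_left (8 / π ^ 2) using 1
    · ext k
      field_simp
      ring
    · field_simp
  · rw [← Complex.ofReal_div]
    exact (hasSum_integral_exp_mul_I_mul_log_coth θ).unique
      (Complex.hasSum_ofReal.mpr (hasSum_tanh hθ))
end
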